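/- Let R be an integral domain of characteristic zero and let f ∈ R[x_1,…,x_n] be a non-constant polynomial. Then the following are equivalent: (1) deg f̂ = deg f − 1; (2) there exist r_1, …, r_n ∈ Q(R), not all zero, such that f ∈ Q(R)[r_1 x_1 + ⋯ + r_n x_n]. -/

import Mathlib

open MvPolynomial

namespace MvPolynomial

section CommSemiring

variable {σ R : Type*} [CommSemiring R]

theorem totalDegree_map_of_injective {S : Type*} [CommSemiring S] {φ : R →+* S}
    (hφ : Function.Injective φ) (p : MvPolynomial σ R) :
    (map φ p).totalDegree = p.totalDegree := by
  rw [totalDegree, totalDegree, support_map_of_injective p hφ]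

theorem totalDegree_pderiv_lt {p : MvPolynomial σ R} {i : σ} (h : pderiv i p ≠ 0) :
    (pderiv i p).totalDegree < p.totalDegree := by
  obtain ⟨m, hm, hmax⟩ := Finset.exists_mem_eq_sup (pderiv i p).support
    (support_nonempty.mpr h) fun s => s.sum fun _ e => e
  have hmem : m + Finsupp.single i 1 ∈ p.support := by
    rw [mem_support_iff, coeff_pderiv] at hm
    exact mem_support_iff.mpr (left_ne_zero_of_mul hm)
  have hle := le_totalDegree hmem
  rw [Finsupp.sum_add_index' (fun _ => rfl) (fun _ _ _ => rfl), Finsupp.sum_single_index rfl] at hle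
  have : (pderiv i p).totalDegree = m.sum fun _ e => e := hmax
  omega

end CommSemiring

theorem exists_eq_C_of_pderiv_eq_zero {σ R : Type*} [CommRing R] [IsDomain R] [CharZero R]
    {p : MvPolynomial σ R} (h : ∀ i, pderiv i p = 0) : ∃ a, p = C a := by
  classical
  refine ⟨coeff 0 p, MvPolynomial.ext _ _ fun m => ?_⟩
  rw [coeff_C]
  split_ifs with hm
  · rw [hm]
  obtain ⟨i, hi⟩ := Finsupp.ne_iff.mp (Ne.symm hm)
  have hsub : m - Finsupp.single i 1 + Finsupp.single i 1 = m :=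
    Finsupp.sub_add_single_one_cancel hi
  have hc := coeff_pderiv (i := i) p (m - Finsupp.single i 1)
  rw [h i, coeff_zero, hsub] at hc
  exact (mul_eq_zero.mp hc.symm).resolve_right (Nat.cast_add_one_ne_zero _)

theorem pderiv_sum_C_mul_X {σ R : Type*} [Fintype σ] [CommSemiring R] (r : σ → R) (j : σ) :
    pderiv j (∑ i, C (r i) * X i : MvPolynomial σ R) = C (r j) := by
  classical
  simp [pderiv_X, Pi.single_apply]

theorem totalDegree_sum_C_mul_X {σ R : Type*} [Fintype σ] [CommSemiring R] [Nontrivial R]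
    {r : σ → R} (hr : r ≠ 0) :
    (∑ i, C (r i) * X i : MvPolynomial σ R).totalDegree = 1 := by
  refine le_antisymm (totalDegree_finsetSum_le fun i _ => ?_) ?_
  · exact (totalDegree_mul _ _).trans (by simp)
  · obtain ⟨j, hj⟩ := Function.ne_iff.mp hr
    have h := totalDegree_pderiv_lt (p := ∑ i, C (r i) * X i) (i := j)
      (by rw [pderiv_sum_C_mul_X]; exact C_ne_zero.mpr hj)
    omega

theorem totalDegree_aeval_of_pos {σ R : Type*} [CommRing R] [IsDomain R]
    {L : MvPolynomial σ R} (hL : 0 < L.totalDegree) (q : Polynomial R) :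
    (Polynomial.aeval L q).totalDegree = q.natDegree * L.totalDegree := by
  induction hn : q.natDegree generalizing q with
  | zero =>
    rw [Polynomial.eq_C_of_natDegree_eq_zero hn, Polynomial.aeval_C, algebraMap_eq, totalDegree_C,
      zero_mul]
  | succ n ih =>
    have hdiv : q.divX.natDegree = n := by
      rw [Polynomial.natDegree_divX_eq_natDegree_tsub_one]; omega
    have hL0 : L ≠ 0 := by rintro rfl; simp at hL
    have h0 : Polynomial.aeval L q.divX ≠ 0 := by
      intro h0
      rcases n.eq_zero_or_pos with rfl | hpos
      · rw [Polynomial.eq_C_of_natDegree_eq_zero hdiv, Polynomial.aeval_C, algebraMap_eq,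
          C_eq_zero, Polynomial.coeff_divX] at h0
        have hlead : q.leadingCoeff = 0 := by rw [Polynomial.leadingCoeff, hn]; exact h0
        rw [Polynomial.leadingCoeff_eq_zero] at hlead
        simp [hlead] at hn
      · have := ih _ hdiv
        rw [h0, totalDegree_zero] at this
        exact (Nat.mul_pos hpos hL).ne this
    have hmul : (Polynomial.aeval L q.divX * L).totalDegree = (n + 1) * L.totalDegree := by
      rw [totalDegree_mul_of_isDomain h0 hL0, ih _ hdiv, add_mul, one_mul]
    nth_rewrite 1 [← q.divX_mul_X_add]
    rw [map_add, map_mul, Polynomial.aeval_X, Polynomial.aeval_C, algebraMap_eq,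
      totalDegree_add_eq_left_of_totalDegree_lt, hmul]
    rw [totalDegree_C, hmul]
    positivity

end MvPolynomial

theorem Polynomial.derivative_surjective {K : Type*} [Field K] [CharZero K] :
    Function.Surjective (Polynomial.derivative (R := K)) := by
  intro q
  induction q using Polynomial.induction_on' with
  | add p q hp hq =>
    obtain ⟨a, rfl⟩ := hp
    obtain ⟨b, rfl⟩ := hq
    exact ⟨a + b, Polynomial.derivative_add⟩
  | monomial n a =>
    refine ⟨Polynomial.monomial (n + 1) (a / (n + 1)), ?_⟩
    rw [Polynomial.derivative_monomial]
    simp [div_mul_cancel₀ a (Nat.cast_add_one_ne_zero n : (n : K) + 1 ≠ 0)]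

namespace MvPolynomial

/-- In characteristic zero, a polynomial whose gradient is everywhere parallel to a constant vector
`r ≠ 0` is a polynomial in the linear form with coefficients `r`. -/
theorem exists_aeval_linear_form_eq {σ K : Type*} [Fintype σ] [Field K] [CharZero K] {r : σ → K}
    {j : σ} (hj : r j ≠ 0) (p : MvPolynomial σ K)
    (hp : ∀ i, C (r j) * pderiv i p = C (r i) * pderiv j p) :
    ∃ q : Polynomial K, Polynomial.aeval (∑ i, C (r i) * X i : MvPolynomial σ K) q = p := by
  induction hn : p.totalDegree using Nat.strong_induction_on generalizing p with
  | _ n ih =>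
    set L : MvPolynomial σ K := ∑ i, C (r i) * X i with hL
    obtain ⟨q, hq⟩ : ∃ q : Polynomial K, Polynomial.aeval L q = pderiv j p := by
      by_cases h0 : pderiv j p = 0
      · exact ⟨0, by rw [map_zero, h0]⟩
      refine ih _ (hn ▸ totalDegree_pderiv_lt h0) _ (fun i => ?_) rfl
      have hcomm : pderiv i (pderiv j p) = pderiv j (pderiv i p) := by
        ext m
        simp only [coeff_pderiv]
        rcases eq_or_ne i j with rfl | hij
        · rfl
        rw [add_right_comm]
        simp [Finsupp.single_eq_of_ne hij, Finsupp.single_eq_of_ne hij.symm, mul_right_comm]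
      rw [hcomm, ← pderiv_C_mul, hp, pderiv_C_mul]
    obtain ⟨Q, hQ⟩ := Polynomial.derivative_surjective (Polynomial.C (r j)⁻¹ * q)
    have hC : (C (r j) : MvPolynomial σ K) * C (r j)⁻¹ = 1 := by
      rw [← C_mul, mul_inv_cancel₀ hj, C_1]
    obtain ⟨a, ha⟩ := exists_eq_C_of_pderiv_eq_zero (p := p - Polynomial.aeval L Q) fun i => by
      rw [map_sub, Derivation.map_aeval, hQ, map_mul, hq, Polynomial.aeval_C, algebraMap_eq,
        hL, pderiv_sum_C_mul_X, smul_eq_mul]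
      linear_combination C (r j)⁻¹ * hp i - pderiv i p * hC
    refine ⟨Q + Polynomial.C a, ?_⟩
    rw [map_add, Polynomial.aeval_C, algebraMap_eq, ← ha, add_sub_cancel]

/-- A common divisor of the partial derivatives that has the largest possible degree forces the
polynomial to be a polynomial in a single linear form. -/
theorem exists_aeval_linear_form_eq_of_dvd_pderiv {σ K : Type*} [Fintype σ] [Field K] [CharZero K]
    {p d : MvPolynomial σ K} (hd : ∀ i, d ∣ pderiv i p)
    (hdeg : d.totalDegree + 1 = p.totalDegree) :
    ∃ r : σ → K, r ≠ 0 ∧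
      ∃ q : Polynomial K, Polynomial.aeval (∑ i, C (r i) * X i : MvPolynomial σ K) q = p := by
  have hconst : ∀ i, ∃ c : K, pderiv i p = d * C c := by
    intro i
    obtain ⟨g, hg⟩ := hd i
    by_cases h0 : pderiv i p = 0
    · exact ⟨0, by simp [h0]⟩
    have hlt := totalDegree_pderiv_lt h0
    have hdg := hg ▸ h0
    rw [hg, totalDegree_mul_of_isDomain (left_ne_zero_of_mul hdg) (right_ne_zero_of_mul hdg)] at hlt
    have hg0 : g.totalDegree = 0 := by omega
    exact ⟨_, by rw [hg, ← totalDegree_eq_zero_iff_eq_C.mp hg0]⟩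
  choose r hr using hconst
  have hr0 : r ≠ 0 := by
    rintro rfl
    obtain ⟨a, rfl⟩ := exists_eq_C_of_pderiv_eq_zero (p := p) fun i => by simp [hr i]
    simp at hdeg
  obtain ⟨j, hj⟩ := Function.ne_iff.mp hr0
  exact ⟨r, hr0, exists_aeval_linear_form_eq hj p fun i => by rw [hr i, hr j]; ring⟩

/-- For a nonconstant polynomial in a linear form, the degree of a greatest common divisor of the
partial derivatives is one less than that of the polynomial. -/
theorem totalDegree_gcd_pderiv_aeval_linear_form {σ K : Type*} [Fintype σ] [Field K] [CharZero K]
    {r : σ → K} (hr : r ≠ 0) {q : Polynomial K} (hq : 0 < q.natDegree) {d : MvPolynomial σ K}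
    (hd1 : ∀ i, d ∣ pderiv i (Polynomial.aeval (∑ i, C (r i) * X i : MvPolynomial σ K) q))
    (hd2 : ∀ e, (∀ i, e ∣ pderiv i
      (Polynomial.aeval (∑ i, C (r i) * X i : MvPolynomial σ K) q)) → e ∣ d) :
    d.totalDegree + 1 =
      (Polynomial.aeval (∑ i, C (r i) * X i : MvPolynomial σ K) q).totalDegree := by
  have hL := totalDegree_sum_C_mul_X hr
  have hLpos : 0 < (∑ i, C (r i) * X i : MvPolynomial σ K).totalDegree := by omega
  simp only [Derivation.map_aeval, pderiv_sum_C_mul_X, smul_eq_mul] at hd1 hd2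
  obtain ⟨j, hj⟩ := Function.ne_iff.mp hr
  have hunit : IsUnit (C (r j) : MvPolynomial σ K) := (isUnit_iff_ne_zero.mpr hj).map C
  have hassoc : Associated d
      (Polynomial.aeval (∑ i, C (r i) * X i : MvPolynomial σ K) q.derivative) :=
    associated_of_dvd_dvd (hunit.dvd_mul_right.mp (hd1 j))
      (hd2 _ fun i => dvd_mul_right _ _)
  have hdeg : d.totalDegree =
      (Polynomial.aeval (∑ i, C (r i) * X i : MvPolynomial σ K) q.derivative).totalDegree := by
    obtain ⟨u, hu⟩ := hassoc
    obtain ⟨c, -, hcu⟩ := isUnit_iff_eq_C_of_isReduced.mp u.isUnit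
    rcases eq_or_ne d 0 with rfl | hd0
    · rw [← hu, zero_mul]
    · rw [← hu, totalDegree_mul_of_isDomain hd0 u.ne_zero, hcu, totalDegree_C, add_zero]
  rw [hdeg, totalDegree_aeval_of_pos hLpos, totalDegree_aeval_of_pos hLpos, hL,
    Polynomial.natDegree_derivative]
  omega

end MvPolynomial

/-- **Lemma 2.4.** Let `R` be an integral domain of characteristic zero and
`f ∈ R[x_1,…,x_n]` non-constant.  Then `deg f̂ = deg f - 1` (where `f̂` is a gcd of the
partial derivatives of `f` in `Q(R)[x_1,…,x_n]`) iff there exist `r_1, …, r_n ∈ Q(R)`,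
not all zero, with `f ∈ Q(R)[r_1 x_1 + ⋯ + r_n x_n]`. -/
theorem totalDegree_gcd_partials_eq_iff_mem_adjoin_linear_form
    (R : Type*) [CommRing R] [IsDomain R] [CharZero R] (n : ℕ)
    (f : MvPolynomial (Fin n) R)
    (hf : ∀ r : R, f ≠ C r)
    (d : MvPolynomial (Fin n) (FractionRing R))
    (hd1 : ∀ i : Fin n,
      d ∣ pderiv i (MvPolynomial.map (algebraMap R (FractionRing R)) f))
    (hd2 : ∀ e : MvPolynomial (Fin n) (FractionRing R),
      (∀ i : Fin n, e ∣ pderiv i (MvPolynomial.map (algebraMap R (FractionRing R)) f)) →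
        e ∣ d) :
    d.totalDegree + 1 = f.totalDegree
      ↔ ∃ r : Fin n → FractionRing R, r ≠ 0 ∧
          MvPolynomial.map (algebraMap R (FractionRing R)) f ∈
            Algebra.adjoin (FractionRing R)
              {(∑ i : Fin n, C (r i) * X i : MvPolynomial (Fin n) (FractionRing R))} := by
  have hinj := IsFractionRing.injective R (FractionRing R)
  have : CharZero (FractionRing R) := charZero_of_injective_algebraMap hinj
  rw [← totalDegree_map_of_injective hinj f]
  simp only [Algebra.adjoin_singleton_eq_range_aeval, AlgHom.mem_range]
  refine ⟨exists_aeval_linear_form_eq_of_dvd_pderiv hd1, ?_⟩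
  rintro ⟨r, hr, q, hq⟩
  rw [← hq] at hd1 hd2 ⊢
  refine totalDegree_gcd_pderiv_aeval_linear_form hr (Nat.pos_of_ne_zero fun h0 => ?_) hd1 hd2
  rw [Polynomial.eq_C_of_natDegree_eq_zero h0, Polynomial.aeval_C] at hq
  have hdeg : f.totalDegree = 0 := by
    rw [← totalDegree_map_of_injective hinj f, ← hq, MvPolynomial.algebraMap_eq, totalDegree_C]
  exact hf _ (totalDegree_eq_zero_iff_eq_C.mp hdeg)
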